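/- (Homogenized even arity-three signatures fill the even subspace.) For every quadruple (t, c₁₂, c₁₃, c₂₃) ∈ ℂ⁴ there exist θ ∈ ℂ and a 5×5 skew-symmetric complex matrix Ξ such that θ·Pf(Ξ_∅) + Pf(Ξ_{{4,5}}) = t and θ·Pf(Ξ_{{i,j}}) + Pf(Ξ_{{i,j,4,5}}) = c_{ij} for each pair {i,j} ⊆ {1,2,3}; moreover θ·Pf(Ξ_I) + Pf(Ξ_{I∪{4,5}}) = 0 automatically for every I ⊆ {1,2,3} of odd cardinality. Consequently every tensor in (ℂ²)^{⊗3} supported on the even-weight basis vectors |000⟩, |110⟩, |101⟩, |011⟩ (including those with zero coefficient on |000⟩) arises as the contraction of the five-legged subPfaffian tensor sPf(Ξ) against the Pfaffian cogate θ⟨00| + ⟨11| on legs 4 and 5. -/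

import Mathlib

/-- The subPfaffian of a skew-symmetric matrix, defined by recursive expansion
along the row of the minimal index of `I`; `pf M I` is the Pfaffian of the principal
submatrix of `M` on the index set `I`.  It is `1` for `I = ∅` and `0` for `|I|` odd. -/
def pf {R : Type*} [CommRing R] (M : ℕ → ℕ → R) (I : Finset ℕ) : R :=
  if h : I.Nonempty then
    ∑ j ∈ I.erase (I.min' h),
      (-1 : R) ^ ((I.filter (fun t => t < j)).card + 1) * M (I.min' h) j *
        pf M ((I.erase (I.min' h)).erase j)
  else 1
termination_by I.card
decreasing_by
  exact lt_of_le_of_lt (Finset.card_le_card (Finset.erase_subset _ _))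
    (Finset.card_erase_lt_of_mem (I.min'_mem h))

theorem pf_empty' {R : Type*} [CommRing R] (M : ℕ → ℕ → R) : pf M ∅ = 1 := by
  rw [pf]; simp

theorem pf_insert_min {R : Type*} [CommRing R] (M : ℕ → ℕ → R) (a : ℕ) (s : Finset ℕ)
    (h : ∀ x ∈ s, a < x) :
    pf M (insert a s) =
      ∑ j ∈ s, (-1 : R) ^ ((s.filter (fun t => t < j)).card) * M a j * pf M (s.erase j) := by
  have ha : a ∉ s := fun H => lt_irrefl _ (h a H)
  have hn : (insert a s).Nonempty := Finset.insert_nonempty a s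
  have hm : (insert a s).min' hn = a := by
    apply le_antisymm
    · exact Finset.min'_le _ _ (Finset.mem_insert_self a s)
    · apply Finset.le_min'
      intro y hy
      rcases Finset.mem_insert.1 hy with rfl | hy
      · exact le_rfl
      · exact (h y hy).le
  rw [pf, dif_pos hn]
  simp only [hm, Finset.erase_insert ha]
  refine Finset.sum_congr rfl fun j hj => ?_
  rw [Finset.filter_insert, if_pos (h j hj), Finset.card_insert_of_notMem (by simp [ha]),
    pow_succ, pow_succ]
  ring

theorem pf_pair {R : Type*} [CommRing R] (M : ℕ → ℕ → R) (a b : ℕ) (h : a < b) :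
    pf M {a, b} = M a b := by
  rw [pf_insert_min M a {b} (by simpa using h)]
  simp [pf_empty', Finset.filter_singleton]

theorem pf_quad {R : Type*} [CommRing R] (M : ℕ → ℕ → R) (a b c d : ℕ)
    (hab : a < b) (hbc : b < c) (hcd : c < d) :
    pf M {a, b, c, d} = M a b * M c d - M a c * M b d + M a d * M b c := by
  have e1 : ({b, c, d} : Finset ℕ).erase b = {c, d} := by ext x; simp; omega
  have e2 : ({b, c, d} : Finset ℕ).erase c = {b, d} := by ext x; simp; omega
  have e3 : ({b, c, d} : Finset ℕ).erase d = {b, c} := by ext x; simp; omega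
  have f1 : ({b, c, d} : Finset ℕ).filter (fun t => t < b) = ∅ := by ext x; simp; omega
  have f2 : ({b, c, d} : Finset ℕ).filter (fun t => t < c) = {b} := by ext x; simp; omega
  have f3 : ({b, c, d} : Finset ℕ).filter (fun t => t < d) = {b, c} := by ext x; simp; omega
  rw [pf_insert_min M a {b, c, d} (by simp; omega)]
  rw [Finset.sum_insert (by simp; omega), Finset.sum_insert (by simp; omega),
    Finset.sum_singleton, e1, e2, e3, f1, f2, f3, pf_pair M c d hcd,
    pf_pair M b d (hbc.trans hcd), pf_pair M b c hbc, Finset.card_pair hbc.ne]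
  simp
  ring

theorem pf_odd {R : Type*} [CommRing R] (M : ℕ → ℕ → R) (I : Finset ℕ) (hI : Odd I.card) :
    pf M I = 0 := by
  induction I using Finset.strongInduction with
  | H I ih =>
    have hn : I.Nonempty := by
      rw [← Finset.card_pos]; exact hI.pos
    rw [pf, dif_pos hn]
    refine Finset.sum_eq_zero fun j hj => ?_
    have h1 := Finset.card_erase_add_one (I.min'_mem hn)
    have h2 := Finset.card_erase_add_one hj
    rw [ih _ ((Finset.erase_subset _ _).trans_ssubset (Finset.erase_ssubset (I.min'_mem hn))),
      mul_zero]
    obtain ⟨k, hk⟩ := hI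
    exact ⟨k - 1, by omega⟩

/-- Every bivector in three dimensions is decomposable. -/
theorem exists_decomp (c12 c13 c23 : ℂ) : ∃ u v : ℕ → ℂ, u 4 = 0 ∧ u 5 = 0 ∧ v 4 = 0 ∧ v 5 = 0 ∧
    -(u 1 * v 2) + v 1 * u 2 = c12 ∧ -(u 1 * v 3) + v 1 * u 3 = c13 ∧
    -(u 2 * v 3) + v 2 * u 3 = c23 := by
  by_cases h : c12 = 0
  · refine ⟨fun i => if i = 1 then -c13 else if i = 2 then -c23 else 0,
      fun i => if i = 3 then 1 else 0, ?_⟩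
    simp [h]
  · refine ⟨fun i => if i = 1 then 1 else if i = 3 then -c23 / c12 else 0,
      fun i => if i = 2 then -c12 else if i = 3 then -c13 else 0, ?_⟩
    simp
    field_simp

/-- Homogenized even arity-three signatures fill the even subspace: for any target
coefficients `(t, c₁₂, c₁₃, c₂₃) ∈ ℂ⁴` there are `θ ∈ ℂ` and a `5×5` skew-symmetric
`Ξ` (indices `1,…,5`) with `θ·Pf(Ξ_∅) + Pf(Ξ_{45}) = t`,
`θ·Pf(Ξ_{ij}) + Pf(Ξ_{ij45}) = c_{ij}` for `{i,j} ⊆ {1,2,3}`, and moreover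
`θ·Pf(Ξ_I) + Pf(Ξ_{I∪{4,5}}) = 0` for every odd-cardinality `I ⊆ {1,2,3}`; i.e.
every even-supported tensor in `(ℂ²)^{⊗3}` is the contraction of `sPf(Ξ)` against
the cogate `θ⟨00| + ⟨11|` on legs 4 and 5. -/
theorem homogenized_even_arity_three (t c12 c13 c23 : ℂ) :
    ∃ (θ : ℂ) (Ξ : ℕ → ℕ → ℂ), (∀ i j, Ξ j i = - Ξ i j) ∧
      θ * pf Ξ (∅ : Finset ℕ) + pf Ξ ({4, 5} : Finset ℕ) = t ∧
      θ * pf Ξ ({1, 2} : Finset ℕ) + pf Ξ ({1, 2, 4, 5} : Finset ℕ) = c12 ∧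
      θ * pf Ξ ({1, 3} : Finset ℕ) + pf Ξ ({1, 3, 4, 5} : Finset ℕ) = c13 ∧
      θ * pf Ξ ({2, 3} : Finset ℕ) + pf Ξ ({2, 3, 4, 5} : Finset ℕ) = c23 ∧
      ∀ I ⊆ ({1, 2, 3} : Finset ℕ), Odd I.card →
        θ * pf Ξ I + pf Ξ (I ∪ ({4, 5} : Finset ℕ)) = 0 := by
  obtain ⟨u, v, u4, u5, v4, v5, h12, h13, h23⟩ := exists_decomp c12 c13 c23
  let A : ℕ → ℕ → ℂ := fun i j => if j = 4 then u i else if j = 5 then v i else 0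
  refine ⟨t, fun i j => A i j - A j i, fun i j => by ring, ?_, ?_, ?_, ?_, ?_⟩
  · rw [pf_empty', pf_pair _ 4 5 (by norm_num)]
    simp [A, u5, v4]
  · rw [pf_pair _ 1 2 (by norm_num),
      pf_quad _ 1 2 4 5 (by norm_num) (by norm_num) (by norm_num), ← h12]
    simp [A, u5, v4]
  · rw [pf_pair _ 1 3 (by norm_num),
      pf_quad _ 1 3 4 5 (by norm_num) (by norm_num) (by norm_num), ← h13]
    simp [A, u5, v4]
  · rw [pf_pair _ 2 3 (by norm_num),
      pf_quad _ 2 3 4 5 (by norm_num) (by norm_num) (by norm_num), ← h23]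
    simp [A, u5, v4]
  · intro I hI hodd
    have hd : Disjoint I ({4, 5} : Finset ℕ) :=
      Finset.disjoint_of_subset_left hI (by decide)
    rw [pf_odd _ I hodd, pf_odd _ (I ∪ {4, 5}), mul_zero, add_zero]
    rw [Finset.card_union_of_disjoint hd]
    exact hodd.add_even (by decide)
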